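/- arXiv:1906.01172 — 2 statements merged into one kernel-verified Lean document; each statement's English description precedes it below -/
import Mathlib

section
/- For every nonzero isotropic vector v ∈ V (i.e. Q[v] = 0, v ≠ 0) satisfying ⟨v,ξ⟩ ≠ 0 and ⟨v,e₁⟩ = 0, there exist p ∈ P^ξ(ℚ) and c ∈ ℚ^× such that p v = c e₀. In other words, the set of isotropic lines [v] with ⟨v,ξ⟩ ≠ 0 and ⟨v,e₁⟩ = 0 forms a single orbit under P^ξ(ℚ), namely the orbit of the line ℚe₀. -/
open Matrix

/-- Index type for `V₁ = ℚ^m`, written as `⟨e₀⟩ ⊕ V₀ ⊕ ⟨e₀'⟩` with `V₀ = ℚ^{m-2}`. -/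
abbrev Idx1 (m : ℕ) : Type := Unit ⊕ Fin (m - 2) ⊕ Unit

/-- Index type for `V = ℚ^{m+2}`, written as `⟨e₁⟩ ⊕ V₁ ⊕ ⟨e₁'⟩`. -/
abbrev Idx (m : ℕ) : Type := Unit ⊕ Idx1 m ⊕ Unit

/-- The matrix `Q₁ = [[0,0,1],[0,Q₀,0],[1,0,0]]`. -/
def Q1mat (m : ℕ) (Q₀ : Matrix (Fin (m - 2)) (Fin (m - 2)) ℚ) :
    Matrix (Idx1 m) (Idx1 m) ℚ := fun i j =>
  match i, j with
  | Sum.inl _, Sum.inr (Sum.inr _) => 1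
  | Sum.inr (Sum.inr _), Sum.inl _ => 1
  | Sum.inr (Sum.inl a), Sum.inr (Sum.inl b) => Q₀ a b
  | _, _ => 0

/-- The matrix `Q = [[0,0,1],[0,Q₁,0],[1,0,0]]`. -/
def Qmat (m : ℕ) (Q₀ : Matrix (Fin (m - 2)) (Fin (m - 2)) ℚ) :
    Matrix (Idx m) (Idx m) ℚ := fun i j =>
  match i, j with
  | Sum.inl _, Sum.inr (Sum.inr _) => 1
  | Sum.inr (Sum.inr _), Sum.inl _ => 1
  | Sum.inr (Sum.inl a), Sum.inr (Sum.inl b) => Q1mat m Q₀ a b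
  | _, _ => 0

/-- The pairing `⟨X, Y⟩ = ᵗX Q Y` on `V = ℚ^{m+2}`. -/
def pairQ (m : ℕ) (Q₀ : Matrix (Fin (m - 2)) (Fin (m - 2)) ℚ) (X Y : Idx m → ℚ) : ℚ :=
  X ⬝ᵥ (Qmat m Q₀).mulVec Y

/-- The pairing `⟨X, Y⟩ = ᵗX Q₁ Y` on `V₁ = ℚ^m`. -/
def pairQ1 (m : ℕ) (Q₀ : Matrix (Fin (m - 2)) (Fin (m - 2)) ℚ) (X Y : Idx1 m → ℚ) : ℚ :=
  X ⬝ᵥ (Q1mat m Q₀).mulVec Y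

/-- The isotropic vector `e₁ = (1,0,…,0)ᵗ ∈ V`. -/
def e1 (m : ℕ) : Idx m → ℚ := fun i => match i with | Sum.inl _ => 1 | _ => 0

/-- The isotropic vector `e₁' = (0,…,0,1)ᵗ ∈ V`. -/
def e1' (m : ℕ) : Idx m → ℚ := fun i => match i with | Sum.inr (Sum.inr _) => 1 | _ => 0

/-- The isotropic vector `e₀ ∈ V₁`. -/
def e0 (m : ℕ) : Idx1 m → ℚ := fun i => match i with | Sum.inl _ => 1 | _ => 0

/-- The isotropic vector `e₀' ∈ V₁`. -/
def e0' (m : ℕ) : Idx1 m → ℚ := fun i => match i with | Sum.inr (Sum.inr _) => 1 | _ => 0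

/-- The embedding `V₁ ↪ V` (middle `m` coordinates). -/
def intoV (m : ℕ) (X : Idx1 m → ℚ) : Idx m → ℚ := fun i =>
  match i with | Sum.inr (Sum.inl a) => X a | _ => 0

/-- `G(ℚ) = O(Q)`, the orthogonal group of `Q`. -/
def Gset (m : ℕ) (Q₀ : Matrix (Fin (m - 2)) (Fin (m - 2)) ℚ) :
    Set (Matrix (Idx m) (Idx m) ℚ) := {g | gᵀ * Qmat m Q₀ * g = Qmat m Q₀}

/-- `G₁(ℚ) = O(Q₁)`, the orthogonal group of `Q₁`. -/
def G1set (m : ℕ) (Q₀ : Matrix (Fin (m - 2)) (Fin (m - 2)) ℚ) :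
    Set (Matrix (Idx1 m) (Idx1 m) ℚ) := {h | hᵀ * Q1mat m Q₀ * h = Q1mat m Q₀}

/-- The Levi element `m(r; h) = diag(r, h, r⁻¹)`. -/
def mElt (m : ℕ) (r : ℚ) (h : Matrix (Idx1 m) (Idx1 m) ℚ) :
    Matrix (Idx m) (Idx m) ℚ := fun i j =>
  match i, j with
  | Sum.inl _, Sum.inl _ => r
  | Sum.inr (Sum.inl a), Sum.inr (Sum.inl b) => h a b
  | Sum.inr (Sum.inr _), Sum.inr (Sum.inr _) => r⁻¹
  | _, _ => 0

/-- The unipotent element `n(X) = [[1, -ᵗX Q₁, -Q₁[X]/2],[0, 1, X],[0, 0, 1]]`. -/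
def nElt (m : ℕ) (Q₀ : Matrix (Fin (m - 2)) (Fin (m - 2)) ℚ) (X : Idx1 m → ℚ) :
    Matrix (Idx m) (Idx m) ℚ := fun i j =>
  match i, j with
  | Sum.inl _, Sum.inl _ => 1
  | Sum.inl _, Sum.inr (Sum.inl b) => -(X ᵥ* Q1mat m Q₀) b
  | Sum.inl _, Sum.inr (Sum.inr _) => -(X ⬝ᵥ (Q1mat m Q₀).mulVec X) / 2
  | Sum.inr (Sum.inl a), Sum.inr (Sum.inl b) => if a = b then 1 else 0
  | Sum.inr (Sum.inl a), Sum.inr (Sum.inr _) => X a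
  | Sum.inr (Sum.inr _), Sum.inr (Sum.inr _) => 1
  | _, _ => 0

/-- The parabolic `P(ℚ) = {m(r;h) n(X)}`, the stabilizer of the line `ℚe₁` in `G(ℚ)`. -/
def Pset (m : ℕ) (Q₀ : Matrix (Fin (m - 2)) (Fin (m - 2)) ℚ) :
    Set (Matrix (Idx m) (Idx m) ℚ) :=
  {g | ∃ r : ℚ, r ≠ 0 ∧ ∃ h ∈ G1set m Q₀, ∃ X : Idx1 m → ℚ,
      g = mElt m r h * nElt m Q₀ X}

/-- The vector `ξ = a e₀ + α + e₀' ∈ V₁`. -/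
def xiVec (m : ℕ) (a : ℚ) (α : Fin (m - 2) → ℚ) : Idx1 m → ℚ := fun i =>
  match i with
  | Sum.inl _ => a
  | Sum.inr (Sum.inl b) => α b
  | Sum.inr (Sum.inr _) => 1

/-- `ξ` viewed inside `V`. -/
def xiV (m : ℕ) (a : ℚ) (α : Fin (m - 2) → ℚ) : Idx m → ℚ := intoV m (xiVec m a α)

/-- `P^ξ(ℚ) = {p ∈ P(ℚ) : pξ = ξ}`. -/
def Pxi (m : ℕ) (Q₀ : Matrix (Fin (m - 2)) (Fin (m - 2)) ℚ) (a : ℚ)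
    (α : Fin (m - 2) → ℚ) : Set (Matrix (Idx m) (Idx m) ℚ) :=
  {p | p ∈ Pset m Q₀ ∧ p.mulVec (xiV m a α) = xiV m a α}

/-- The Weyl element `𝔴₀` : `e₁ ↦ -e₁'`, `e₁' ↦ -e₁`, identity on `V₁`. -/
def w0 (m : ℕ) : Matrix (Idx m) (Idx m) ℚ := fun i j =>
  match i, j with
  | Sum.inr (Sum.inr _), Sum.inl _ => -1
  | Sum.inl _, Sum.inr (Sum.inr _) => -1
  | Sum.inr (Sum.inl a), Sum.inr (Sum.inl b) => if a = b then 1 else 0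
  | _, _ => 0

/-- The Weyl element `𝔴₁` : `e₁ ↔ e₀`, `e₁' ↔ e₀'`, identity on `V₀`. -/
def w1 (m : ℕ) : Matrix (Idx m) (Idx m) ℚ := fun i j =>
  match i, j with
  | Sum.inr (Sum.inl (Sum.inl _)), Sum.inl _ => 1
  | Sum.inl _, Sum.inr (Sum.inl (Sum.inl _)) => 1
  | Sum.inr (Sum.inl (Sum.inr (Sum.inr _))), Sum.inr (Sum.inr _) => 1
  | Sum.inr (Sum.inr _), Sum.inr (Sum.inl (Sum.inr (Sum.inr _))) => 1
  | Sum.inr (Sum.inl (Sum.inr (Sum.inl a))), Sum.inr (Sum.inl (Sum.inr (Sum.inl b))) =>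
      if a = b then 1 else 0
  | _, _ => 0

/-- The double coset `P^ξ(ℚ) u P(ℚ)`. -/
def DCoset (m : ℕ) (Q₀ : Matrix (Fin (m - 2)) (Fin (m - 2)) ℚ) (a : ℚ)
    (α : Fin (m - 2) → ℚ) (u : Matrix (Idx m) (Idx m) ℚ) :
    Set (Matrix (Idx m) (Idx m) ℚ) :=
  {g | ∃ p ∈ Pxi m Q₀ a α, ∃ q ∈ Pset m Q₀, g = p * u * q}

theorem refl_orth {n : Type} [Fintype n] [DecidableEq n] (B : Matrix n n ℚ) (hB : B.IsSymm)
    (u : n → ℚ) (k : ℚ) (hk : k * (u ⬝ᵥ B *ᵥ u) = 2) :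
    (1 - k • vecMulVec u (B *ᵥ u))ᵀ * B * (1 - k • vecMulVec u (B *ᵥ u)) = B := by
  have h1 : u ᵥ* B = B *ᵥ u := by
    rw [← Matrix.mulVec_transpose, hB.eq]
  rw [transpose_sub, transpose_smul, transpose_vecMulVec, transpose_one, sub_mul, one_mul,
    Matrix.smul_mul, vecMulVec_mul, h1, mul_sub, mul_one, sub_mul, Matrix.mul_smul, mul_vecMulVec,
    Matrix.smul_mul, Matrix.mul_smul, vecMulVec_mul_vecMulVec]
  ext i j
  simp only [Matrix.sub_apply, Matrix.smul_apply, vecMulVec_apply, smul_eq_mul, Pi.smul_apply]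
  have h2 : (B *ᵥ u) ⬝ᵥ u = u ⬝ᵥ B *ᵥ u := dotProduct_comm _ _
  simp only [h2]
  linear_combination (k * (B *ᵥ u) i * (B *ᵥ u) j) * hk

theorem refl_mulVec {n : Type} [Fintype n] [DecidableEq n] (B : Matrix n n ℚ)
    (u : n → ℚ) (k : ℚ) (y : n → ℚ) :
    (1 - k • vecMulVec u (B *ᵥ u)) *ᵥ y = y - (k * (y ⬝ᵥ B *ᵥ u)) • u := by
  rw [sub_mulVec, one_mulVec, smul_mulVec, vecMulVec_mulVec, dotProduct_comm]
  ext i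
  simp
  ring

theorem Q1_symm (m : ℕ) (Q₀ : Matrix (Fin (m - 2)) (Fin (m - 2)) ℚ) (hsym : Q₀.IsSymm) :
    (Q1mat m Q₀).IsSymm := by
  ext i j
  rcases i with _ | i | _ <;> rcases j with _ | j | _ <;> simp [Q1mat]
  exact hsym.apply _ _

theorem pairQ1_comm (m : ℕ) (Q₀ : Matrix (Fin (m - 2)) (Fin (m - 2)) ℚ) (hsym : Q₀.IsSymm)
    (X Y : Idx1 m → ℚ) : pairQ1 m Q₀ X Y = pairQ1 m Q₀ Y X := by
  unfold pairQ1
  rw [dotProduct_mulVec, ← mulVec_transpose, (Q1_symm m Q₀ hsym).eq, dotProduct_comm]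

theorem pairQ1_eq (m : ℕ) (Q₀ : Matrix (Fin (m - 2)) (Fin (m - 2)) ℚ)
    (X Y : Idx1 m → ℚ) : pairQ1 m Q₀ X Y =
      X (.inl ()) * Y (.inr (.inr ())) + X (.inr (.inr ())) * Y (.inl ())
      + (fun i => X (.inr (.inl i))) ⬝ᵥ Q₀ *ᵥ (fun i => Y (.inr (.inl i))) := by
  simp [pairQ1, dotProduct, mulVec, Q1mat]
  ring

theorem pairQ_eq (m : ℕ) (Q₀ : Matrix (Fin (m - 2)) (Fin (m - 2)) ℚ)
    (X Y : Idx m → ℚ) : pairQ m Q₀ X Y =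
      X (.inl ()) * Y (.inr (.inr ())) + X (.inr (.inr ())) * Y (.inl ())
      + pairQ1 m Q₀ (fun i => X (.inr (.inl i))) (fun i => Y (.inr (.inl i))) := by
  unfold pairQ pairQ1
  simp only [dotProduct, mulVec, Qmat, Fintype.sum_sum_type (α₁ := Unit) (α₂ := Idx1 m ⊕ Unit),
    Fintype.sum_sum_type (α₁ := Idx1 m) (α₂ := Unit)]
  simp
  ring

/-- the vector `x e₁ + w`. -/
def vecXW (m : ℕ) (x : ℚ) (w : Idx1 m → ℚ) : Idx m → ℚ := fun i =>
  match i with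
  | Sum.inl _ => x
  | Sum.inr (Sum.inl b) => w b
  | Sum.inr (Sum.inr _) => 0

theorem nElt_mulVec (m : ℕ) (Q₀ : Matrix (Fin (m - 2)) (Fin (m - 2)) ℚ) (X : Idx1 m → ℚ)
    (x : ℚ) (w : Idx1 m → ℚ) :
    nElt m Q₀ X *ᵥ vecXW m x w = vecXW m (x - pairQ1 m Q₀ X w) w := by
  unfold pairQ1
  rw [dotProduct_mulVec]
  ext i
  rcases i with _ | i | _
  all_goals
    simp only [dotProduct, mulVec, nElt, vecXW,
      Fintype.sum_sum_type (α₁ := Unit) (α₂ := Idx1 m ⊕ Unit),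
      Fintype.sum_sum_type (α₁ := Idx1 m) (α₂ := Unit)]
  · simp only [neg_mul, Finset.sum_neg_distrib, Finset.univ_unique, Finset.sum_const,
      Finset.card_singleton, one_smul]
    ring
  · simp only [zero_mul, mul_zero, Finset.sum_const_zero, ite_mul, one_mul, Finset.sum_ite_eq,
      Finset.mem_univ, if_true, add_zero, zero_add]
  · simp only [zero_mul, mul_zero, Finset.sum_const_zero, add_zero]

theorem mElt_mulVec (m : ℕ) (h : Matrix (Idx1 m) (Idx1 m) ℚ) (x : ℚ) (w : Idx1 m → ℚ) :
    mElt m 1 h *ᵥ vecXW m x w = vecXW m x (h *ᵥ w) := by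
  ext i
  rcases i with _ | i | _
  all_goals
    simp only [dotProduct, mulVec, mElt, vecXW,
      Fintype.sum_sum_type (α₁ := Unit) (α₂ := Idx1 m ⊕ Unit),
      Fintype.sum_sum_type (α₁ := Idx1 m) (α₂ := Unit)]
  all_goals simp only [zero_mul, mul_zero, Finset.sum_const_zero, add_zero, zero_add, one_mul,
    Finset.univ_unique, Finset.sum_const, Finset.card_singleton, one_smul]

theorem exists_h (m : ℕ) (Q₀ : Matrix (Fin (m - 2)) (Fin (m - 2)) ℚ) (hsym : Q₀.IsSymm)
    (hpos : ∀ x : Fin (m - 2) → ℚ, x ≠ 0 → 0 < x ⬝ᵥ Q₀.mulVec x)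
    (a : ℚ) (α : Fin (m - 2) → ℚ) (w : Idx1 m → ℚ) (hw : pairQ1 m Q₀ w w = 0)
    (hc0 : pairQ1 m Q₀ w (xiVec m a α) ≠ 0) :
    ∃ h ∈ G1set m Q₀, h *ᵥ xiVec m a α = xiVec m a α ∧
      h *ᵥ w = pairQ1 m Q₀ w (xiVec m a α) • e0 m := by
  set c := pairQ1 m Q₀ w (xiVec m a α) with hc
  have e0ξ : pairQ1 m Q₀ (e0 m) (xiVec m a α) = 1 := by
    simp [pairQ1_eq, e0, xiVec, dotProduct]
  have e0e0 : pairQ1 m Q₀ (e0 m) (e0 m) = 0 := by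
    simp [pairQ1_eq, e0, dotProduct]
  have sub_r : ∀ X Y Z : Idx1 m → ℚ,
      pairQ1 m Q₀ X (Y - c • Z) = pairQ1 m Q₀ X Y - c * pairQ1 m Q₀ X Z := by
    intro X Y Z
    simp [pairQ1, mulVec_sub, mulVec_smul, dotProduct_sub]
  have comm := pairQ1_comm m Q₀ hsym
  by_cases hz : pairQ1 m Q₀ w (e0 m) = 0
  · have h1 : w (.inr (.inr ())) = 0 := by
      simpa [pairQ1_eq, e0, dotProduct, mulVec] using hz
    have h2 : (fun i => w (.inr (.inl i))) = 0 := by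
      by_contra hne
      have := hpos _ hne
      rw [pairQ1_eq, h1] at hw
      linarith
    have h3 : w = c • e0 m := by
      have hc' : c = w (.inl ()) := by
        rw [hc, pairQ1_eq, h1, h2]; simp [xiVec]
      ext i
      rcases i with _ | i | _
      · simp [e0, hc']
      · simpa [e0] using congrFun h2 i
      · simpa [e0] using h1
    exact ⟨1, by simp [G1set], by simp, by simpa using h3⟩
  · set u := w - c • e0 m with hu
    have hwu : pairQ1 m Q₀ w u = - c * pairQ1 m Q₀ w (e0 m) := by
      rw [hu, sub_r, hw]; ring
    have hξu : pairQ1 m Q₀ (xiVec m a α) u = 0 := by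
      rw [hu, sub_r, comm _ w, comm _ (e0 m), e0ξ, ← hc]; ring
    have huu : pairQ1 m Q₀ u u = - 2 * c * pairQ1 m Q₀ w (e0 m) := by
      rw [hu, sub_r, comm _ w, comm _ (e0 m), sub_r, sub_r, hw, e0e0, comm (e0 m) w]; ring
    refine ⟨1 - (2 / pairQ1 m Q₀ u u) • vecMulVec u (Q1mat m Q₀ *ᵥ u), ?_, ?_, ?_⟩
    · apply refl_orth _ (Q1_symm m Q₀ hsym)
      change 2 / pairQ1 m Q₀ u u * pairQ1 m Q₀ u u = 2
      apply div_mul_cancel₀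
      rw [huu]
      simp [hc0, hz]
    · rw [refl_mulVec]
      change _ - (_ * pairQ1 m Q₀ (xiVec m a α) u) • u = _
      rw [hξu]; simp
    · rw [refl_mulVec]
      change _ - (2 / pairQ1 m Q₀ u u * pairQ1 m Q₀ w u) • u = _
      have : 2 / pairQ1 m Q₀ u u * pairQ1 m Q₀ w u = 1 := by
        rw [huu, hwu]; field_simp
      rw [this, hu]; simp

/-- Every nonzero isotropic `v ∈ V` with `⟨v,ξ⟩ ≠ 0` and `⟨v,e₁⟩ = 0` can be
mapped by some `p ∈ P^ξ(ℚ)` to a nonzero multiple of `e₀`; i.e. the corresponding isotropic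
lines form a single `P^ξ(ℚ)`-orbit, the orbit of the line `ℚe₀`. -/
theorem stmt3 (m : ℕ) (hm : 3 ≤ m)
    (Q₀ : Matrix (Fin (m - 2)) (Fin (m - 2)) ℚ) (hsym : Q₀.IsSymm)
    (hpos : ∀ x : Fin (m - 2) → ℚ, x ≠ 0 → 0 < x ⬝ᵥ Q₀.mulVec x)
    (a : ℚ) (α : Fin (m - 2) → ℚ)
    (hξ : pairQ1 m Q₀ (xiVec m a α) (xiVec m a α) < 0)
    (v : Idx m → ℚ) (hv0 : v ≠ 0) (hiso : pairQ m Q₀ v v = 0)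
    (hvξ : pairQ m Q₀ v (xiV m a α) ≠ 0) (hve1 : pairQ m Q₀ v (e1 m) = 0) :
    ∃ p ∈ Pxi m Q₀ a α, ∃ c : ℚ, c ≠ 0 ∧ p.mulVec v = c • intoV m (e0 m) := by
  have hz : v (.inr (.inr ())) = 0 := by
    rw [pairQ_eq] at hve1
    simpa [e1, pairQ1, dotProduct, mulVec] using hve1
  set w : Idx1 m → ℚ := fun i => v (.inr (.inl i)) with hw
  set ξ := xiVec m a α with hξd
  have hv : v = vecXW m (v (.inl ())) w := by
    ext i
    rcases i with _ | i | _
    · rfl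
    · rfl
    · exact hz
  have hx : xiV m a α = vecXW m 0 ξ := by
    ext i
    rcases i with _ | i | _ <;> rfl
  have hww : pairQ1 m Q₀ w w = 0 := by
    rw [pairQ_eq, hz] at hiso
    simpa using hiso
  have hwξ : pairQ1 m Q₀ w ξ ≠ 0 := by
    rw [pairQ_eq, hz] at hvξ
    simpa [xiV, intoV] using hvξ
  obtain ⟨h, hG, h1, h2⟩ := exists_h m Q₀ hsym hpos a α w hww hwξ
  set c := pairQ1 m Q₀ w ξ with hc
  set q := pairQ1 m Q₀ ξ ξ with hq
  set x := v (.inl ()) with hxd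
  have lin : ∀ (s t : ℚ) (Y : Idx1 m → ℚ), pairQ1 m Q₀ (s • w + t • ξ) Y =
      s * pairQ1 m Q₀ w Y + t * pairQ1 m Q₀ ξ Y := by
    intro s t Y
    simp [pairQ1, add_dotProduct]
  have hq0 : q ≠ 0 := hξ.ne
  refine ⟨mElt m 1 h * nElt m Q₀ ((-x * q / c ^ 2) • w + (x / c) • ξ),
    ⟨⟨1, one_ne_zero, h, hG, _, rfl⟩, ?_⟩, c, hwξ, ?_⟩
  · rw [hx, ← mulVec_mulVec, nElt_mulVec, mElt_mulVec, h1, lin, ← hc, ← hq]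
    congr 1
    field_simp
    ring
  · rw [hv, ← mulVec_mulVec, nElt_mulVec, mElt_mulVec, h2, lin, hww,
      pairQ1_comm m Q₀ hsym ξ w, ← hc]
    have : x - (-x * q / c ^ 2 * 0 + x / c * c) = 0 := by
      field_simp
      ring
    rw [this]
    ext i
    rcases i with _ | i | _ <;> simp [vecXW, intoV]
end

section
/- Let P₁⁰(ℚ) denote the stabilizer in G₁(ℚ) of the line ℚe₀. Then the set P^ξ(ℚ)𝔴₁P(ℚ) is the union over t ∈ ℚ^× and δ ∈ G₁(ℚ) of the sets P^ξ(ℚ)𝔴₁ m(t;δ) N(ℚ); moreover: (a) if t₁ = t₂ and δ₁δ₂⁻¹ ∈ P₁⁰(ℚ), then P^ξ(ℚ)𝔴₁ m(t₁;δ₁) N(ℚ) = P^ξ(ℚ)𝔴₁ m(t₂;δ₂) N(ℚ); and (b) conversely, if P^ξ(ℚ)𝔴₁ m(t₁;δ₁) N(ℚ) and P^ξ(ℚ)𝔴₁ m(t₂;δ₂) N(ℚ) have a common element, then t₁ = t₂ and δ₁δ₂⁻¹ ∈ P₁⁰(ℚ). Hence P^ξ(ℚ)𝔴₁P(ℚ)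 is the disjoint union of the sets P^ξ(ℚ)𝔴₁ m(t;δ) N(ℚ) indexed by t ∈ ℚ^× and the cosets δ ∈ P₁⁰(ℚ)\G₁(ℚ). -/
open Matrix

/-- `P₁⁰(ℚ)`, the stabilizer in `G₁(ℚ)` of the line `ℚe₀`. -/
def P10 (m : ℕ) (Q₀ : Matrix (Fin (m - 2)) (Fin (m - 2)) ℚ) :
    Set (Matrix (Idx1 m) (Idx1 m) ℚ) :=
  {h | h ∈ G1set m Q₀ ∧ ∃ c : ℚ, c ≠ 0 ∧ h.mulVec (e0 m) = c • e0 m}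

/-- The set `P^ξ(ℚ) 𝔴₁ m(t;δ) N(ℚ)`. -/
def smallCoset (m : ℕ) (Q₀ : Matrix (Fin (m - 2)) (Fin (m - 2)) ℚ) (a : ℚ)
    (α : Fin (m - 2) → ℚ) (t : ℚ) (δ : Matrix (Idx1 m) (Idx1 m) ℚ) :
    Set (Matrix (Idx m) (Idx m) ℚ) :=
  {g | ∃ p ∈ Pxi m Q₀ a α, ∃ X : Idx1 m → ℚ, g = p * w1 m * mElt m t δ * nElt m Q₀ X}

section Helpers

/-- Triple vector. -/
def tv {ι : Type} (x : ℚ) (X : ι → ℚ) (y : ℚ) : Unit ⊕ ι ⊕ Unit → ℚ :=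
  Sum.elim (fun _ => x) (Sum.elim X (fun _ => y))

lemma tv_surj {ι : Type} (v : Unit ⊕ ι ⊕ Unit → ℚ) : ∃ x X y, v = tv x X y :=
  ⟨v (Sum.inl ()), fun i => v (Sum.inr (Sum.inl i)), v (Sum.inr (Sum.inr ())), by
    funext i; rcases i with i | i | i <;> rfl⟩

lemma tv_inj {ι : Type} {x x' : ℚ} {X X' : ι → ℚ} {y y' : ℚ} (h : tv x X y = tv x' X' y') :
    x = x' ∧ X = X' ∧ y = y' :=
  ⟨congrFun h (Sum.inl ()), funext fun i => congrFun h (Sum.inr (Sum.inl i)),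
    congrFun h (Sum.inr (Sum.inr ()))⟩

lemma smul_tv {ι : Type} (c x : ℚ) (X : ι → ℚ) (y : ℚ) :
    c • tv x X y = tv (c * x) (c • X) (c * y) := by
  funext i; rcases i with i | i | i <;> simp [tv]

lemma add_tv {ι : Type} (x : ℚ) (X : ι → ℚ) (y x' : ℚ) (X' : ι → ℚ) (y' : ℚ) :
    tv x X y + tv x' X' y' = tv (x + x') (X + X') (y + y') := by
  funext i; rcases i with i | i | i <;> simp [tv]

variable {m : ℕ} {Q₀ : Matrix (Fin (m - 2)) (Fin (m - 2)) ℚ}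

lemma e0_eq : e0 m = tv 1 0 0 := by
  funext i; rcases i with i | i | i <;> rfl

lemma e1_eq : e1 m = tv 1 0 0 := by
  funext i; rcases i with i | i | i <;> rfl

lemma xiVec_eq (a : ℚ) (α : Fin (m - 2) → ℚ) : xiVec m a α = tv a α 1 := by
  funext i; rcases i with i | i | i <;> rfl

lemma xiV_eq (a : ℚ) (α : Fin (m - 2) → ℚ) : xiV m a α = tv 0 (tv a α 1) 0 := by
  funext i; rcases i with i | (i | i | i) | i <;> rfl

lemma Q1_tv (x : ℚ) (X : Fin (m - 2) → ℚ) (y : ℚ) :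
    Q1mat m Q₀ *ᵥ tv x X y = tv y (Q₀ *ᵥ X) x := by
  funext i
  rcases i with i | i | i <;>
    simp [Matrix.mulVec, dotProduct, Fintype.sum_sum_type, tv, Q1mat]

lemma Q_tv (x : ℚ) (X : Idx1 m → ℚ) (y : ℚ) :
    Qmat m Q₀ *ᵥ tv x X y = tv y (Q1mat m Q₀ *ᵥ X) x := by
  funext i
  rcases i with i | i | i <;>
    simp [Matrix.mulVec, dotProduct, tv, Qmat]

lemma m_tv (r : ℚ) (h : Matrix (Idx1 m) (Idx1 m) ℚ) (x : ℚ) (X : Idx1 m → ℚ) (y : ℚ) :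
    mElt m r h *ᵥ tv x X y = tv (r * x) (h *ᵥ X) (r⁻¹ * y) := by
  funext i
  rcases i with i | i | i <;>
    simp [Matrix.mulVec, dotProduct, tv, mElt]

lemma n_tv (Y : Idx1 m → ℚ) (x : ℚ) (X : Idx1 m → ℚ) (y : ℚ) :
    nElt m Q₀ Y *ᵥ tv x X y =
      tv (x - pairQ1 m Q₀ Y X - y * pairQ1 m Q₀ Y Y / 2) (X + y • Y) y := by
  have hp : pairQ1 m Q₀ Y X = (Y ᵥ* Q1mat m Q₀) ⬝ᵥ X := by
    rw [pairQ1, Matrix.dotProduct_mulVec]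
  rw [hp]
  funext i
  rcases i with i | i | i
  · rw [Matrix.mulVec, dotProduct, Fintype.sum_sum_type, Fintype.sum_sum_type]
    simp only [tv, nElt, pairQ1, Sum.elim_inl, Sum.elim_inr, Finset.univ_unique,
      Finset.sum_singleton, neg_mul, Finset.sum_neg_distrib, dotProduct]
    ring
  · rw [Matrix.mulVec, dotProduct, Fintype.sum_sum_type, Fintype.sum_sum_type]
    simp only [tv, nElt, Sum.elim_inl, Sum.elim_inr, Finset.univ_unique,
      Finset.sum_singleton, Pi.add_apply, Pi.smul_apply, smul_eq_mul]
    simp [mul_comm]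
  · rw [Matrix.mulVec, dotProduct, Fintype.sum_sum_type, Fintype.sum_sum_type]
    simp [tv, nElt]

lemma w_tv (x p : ℚ) (A : Fin (m - 2) → ℚ) (q y : ℚ) :
    w1 m *ᵥ tv x (tv p A q) y = tv p (tv x A y) q := by
  funext i
  rcases i with i | (i | i | i) | i <;>
    simp [Matrix.mulVec, dotProduct, Fintype.sum_sum_type, tv, w1]

lemma pair_tv (x : ℚ) (X : Idx1 m → ℚ) (y x' : ℚ) (X' : Idx1 m → ℚ) (y' : ℚ) :
    pairQ m Q₀ (tv x X y) (tv x' X' y') = x * y' + y * x' + pairQ1 m Q₀ X X' := by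
  rw [pairQ, Q_tv, pairQ1, dotProduct, Fintype.sum_sum_type, Fintype.sum_sum_type]
  simp only [tv, Sum.elim_inl, Sum.elim_inr, Finset.univ_unique, Finset.sum_singleton, dotProduct]
  ring

lemma pair1_tv (x : ℚ) (X : Fin (m - 2) → ℚ) (y x' : ℚ) (X' : Fin (m - 2) → ℚ) (y' : ℚ) :
    pairQ1 m Q₀ (tv x X y) (tv x' X' y') = x * y' + y * x' + X ⬝ᵥ Q₀ *ᵥ X' := by
  rw [pairQ1, Q1_tv, dotProduct, Fintype.sum_sum_type, Fintype.sum_sum_type]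
  simp only [tv, Sum.elim_inl, Sum.elim_inr, Finset.univ_unique, Finset.sum_singleton, dotProduct]
  ring

lemma pair1_add_left (X Y Z : Idx1 m → ℚ) :
    pairQ1 m Q₀ (X + Y) Z = pairQ1 m Q₀ X Z + pairQ1 m Q₀ Y Z := by
  simp [pairQ1, add_dotProduct]

lemma pair1_add_right (X Y Z : Idx1 m → ℚ) :
    pairQ1 m Q₀ X (Y + Z) = pairQ1 m Q₀ X Y + pairQ1 m Q₀ X Z := by
  simp [pairQ1, Matrix.mulVec_add]

lemma pair1_smul_left (c : ℚ) (X Y : Idx1 m → ℚ) :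
    pairQ1 m Q₀ (c • X) Y = c * pairQ1 m Q₀ X Y := by
  simp [pairQ1]

lemma pair1_smul_right (c : ℚ) (X Y : Idx1 m → ℚ) :
    pairQ1 m Q₀ X (c • Y) = c * pairQ1 m Q₀ X Y := by
  simp [pairQ1, Matrix.mulVec_smul]

lemma pair1_zero_right (X : Idx1 m → ℚ) : pairQ1 m Q₀ X 0 = 0 := by simp [pairQ1]

lemma pair1_zero_left (X : Idx1 m → ℚ) : pairQ1 m Q₀ 0 X = 0 := by simp [pairQ1]

lemma pair1_symm (hsym : Q₀.IsSymm) (X Y : Idx1 m → ℚ) :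
    pairQ1 m Q₀ X Y = pairQ1 m Q₀ Y X := by
  have hs : (Q1mat m Q₀)ᵀ = Q1mat m Q₀ := by
    ext i j
    rcases i with i | i | i <;> rcases j with j | j | j <;>
      simp [Q1mat, Matrix.transpose_apply, hsym.apply]
  rw [pairQ1, pairQ1, Matrix.dotProduct_mulVec, ← Matrix.mulVec_transpose, hs, dotProduct_comm]

lemma mat_ext {ι : Type} [Fintype ι] [DecidableEq ι] {A B : Matrix ι ι ℚ}
    (h : ∀ v, A *ᵥ v = B *ᵥ v) : A = B := by
  ext i j
  have := congrFun (h (Pi.single j 1)) i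
  simpa using this

lemma orth_iff {ι : Type} [Fintype ι] [DecidableEq ι] {A g : Matrix ι ι ℚ} :
    gᵀ * A * g = A ↔ ∀ v w, (g *ᵥ v) ⬝ᵥ A *ᵥ (g *ᵥ w) = v ⬝ᵥ A *ᵥ w := by
  have key : ∀ v w, (g *ᵥ v) ⬝ᵥ A *ᵥ (g *ᵥ w) = v ⬝ᵥ (gᵀ * A * g) *ᵥ w := by
    intro v w
    rw [← Matrix.mulVec_mulVec, ← Matrix.mulVec_mulVec, Matrix.dotProduct_mulVec v,
      Matrix.vecMul_transpose]
  constructor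
  · intro h v w
    rw [key, h]
  · intro h
    ext i j
    have := h (Pi.single i 1) (Pi.single j 1)
    rw [key] at this
    simpa using this

lemma G_iff {g : Matrix (Idx m) (Idx m) ℚ} :
    g ∈ Gset m Q₀ ↔ ∀ v w, pairQ m Q₀ (g *ᵥ v) (g *ᵥ w) = pairQ m Q₀ v w := orth_iff

lemma G1_iff {g : Matrix (Idx1 m) (Idx1 m) ℚ} :
    g ∈ G1set m Q₀ ↔ ∀ v w, pairQ1 m Q₀ (g *ᵥ v) (g *ᵥ w) = pairQ1 m Q₀ v w := orth_iff

lemma orth_unit {ι : Type} [Fintype ι] [DecidableEq ι] {A g : Matrix ι ι ℚ}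
    (hA : ∀ v, A *ᵥ v = 0 → v = 0) (h : gᵀ * A * g = A) : IsUnit g := by
  rw [← Matrix.mulVec_injective_iff_isUnit]
  intro v w hvw
  have h1 : g *ᵥ (v - w) = 0 := by
    rw [Matrix.mulVec_sub]; exact sub_eq_zero.2 hvw
  have h2 : A *ᵥ (v - w) = 0 := by
    rw [← h, ← Matrix.mulVec_mulVec, h1, Matrix.mulVec_zero]
  exact sub_eq_zero.1 (hA _ h2)

lemma zero_tv {ι : Type} : (0 : Unit ⊕ ι ⊕ Unit → ℚ) = tv 0 0 0 := by
  funext i; rcases i with i | i | i <;> rfl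

lemma Q1_nondeg (hpos : ∀ x : Fin (m - 2) → ℚ, x ≠ 0 → 0 < x ⬝ᵥ Q₀.mulVec x)
    (v : Idx1 m → ℚ) (h : Q1mat m Q₀ *ᵥ v = 0) : v = 0 := by
  obtain ⟨x, X, y, rfl⟩ := tv_surj v
  rw [Q1_tv, zero_tv] at h
  obtain ⟨rfl, h2, rfl⟩ := tv_inj h
  have : X = 0 := by
    by_contra hX
    have := hpos X hX
    rw [h2] at this
    simp at this
  rw [this, zero_tv]

lemma Q_nondeg (hpos : ∀ x : Fin (m - 2) → ℚ, x ≠ 0 → 0 < x ⬝ᵥ Q₀.mulVec x)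
    (v : Idx m → ℚ) (h : Qmat m Q₀ *ᵥ v = 0) : v = 0 := by
  obtain ⟨x, X, y, rfl⟩ := tv_surj v
  rw [Q_tv, zero_tv] at h
  obtain ⟨rfl, h2, rfl⟩ := tv_inj h
  rw [Q1_nondeg hpos X h2]
  exact zero_tv.symm

lemma G1_unit (hpos : ∀ x : Fin (m - 2) → ℚ, x ≠ 0 → 0 < x ⬝ᵥ Q₀.mulVec x)
    {h : Matrix (Idx1 m) (Idx1 m) ℚ} (hh : h ∈ G1set m Q₀) : IsUnit h :=
  orth_unit (Q1_nondeg hpos) hh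

lemma mul_inv_vec {ι : Type} [Fintype ι] [DecidableEq ι] {h : Matrix ι ι ℚ} (hu : IsUnit h)
    (v : ι → ℚ) : h *ᵥ (h⁻¹ *ᵥ v) = v := by
  rw [Matrix.mulVec_mulVec, Matrix.mul_nonsing_inv _ ((Matrix.isUnit_iff_isUnit_det _).1 hu),
    Matrix.one_mulVec]

lemma inv_mul_vec {ι : Type} [Fintype ι] [DecidableEq ι] {h : Matrix ι ι ℚ} (hu : IsUnit h)
    (v : ι → ℚ) : h⁻¹ *ᵥ (h *ᵥ v) = v := by
  rw [Matrix.mulVec_mulVec, Matrix.nonsing_inv_mul _ ((Matrix.isUnit_iff_isUnit_det _).1 hu),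
    Matrix.one_mulVec]

lemma G1_inv (hpos : ∀ x : Fin (m - 2) → ℚ, x ≠ 0 → 0 < x ⬝ᵥ Q₀.mulVec x)
    {h : Matrix (Idx1 m) (Idx1 m) ℚ} (hh : h ∈ G1set m Q₀) : h⁻¹ ∈ G1set m Q₀ := by
  have hu := G1_unit hpos hh
  rw [G1_iff] at hh ⊢
  intro v w
  rw [← hh, mul_inv_vec hu, mul_inv_vec hu]

lemma G1_mul {h k : Matrix (Idx1 m) (Idx1 m) ℚ} (hh : h ∈ G1set m Q₀) (hk : k ∈ G1set m Q₀) :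
    h * k ∈ G1set m Q₀ := by
  rw [G1_iff] at *
  intro v w
  rw [← Matrix.mulVec_mulVec, ← Matrix.mulVec_mulVec, hh, hk]

lemma G_mul {h k : Matrix (Idx m) (Idx m) ℚ} (hh : h ∈ Gset m Q₀) (hk : k ∈ Gset m Q₀) :
    h * k ∈ Gset m Q₀ := by
  rw [G_iff] at *
  intro v w
  rw [← Matrix.mulVec_mulVec, ← Matrix.mulVec_mulVec, hh, hk]

lemma m_G {r : ℚ} (hr : r ≠ 0) {h : Matrix (Idx1 m) (Idx1 m) ℚ} (hh : h ∈ G1set m Q₀) :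
    mElt m r h ∈ Gset m Q₀ := by
  rw [G_iff]
  rw [G1_iff] at hh
  intro v w
  obtain ⟨x, X, y, rfl⟩ := tv_surj v
  obtain ⟨x', X', y', rfl⟩ := tv_surj w
  rw [m_tv, m_tv, pair_tv, pair_tv, hh]
  field_simp

lemma n_G (hsym : Q₀.IsSymm) (Y : Idx1 m → ℚ) : nElt m Q₀ Y ∈ Gset m Q₀ := by
  rw [G_iff]
  intro v w
  obtain ⟨x, X, y, rfl⟩ := tv_surj v
  obtain ⟨x', X', y', rfl⟩ := tv_surj w
  rw [n_tv, n_tv, pair_tv, pair_tv]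
  simp only [pair1_add_left, pair1_add_right, pair1_smul_left, pair1_smul_right]
  rw [pair1_symm hsym X Y]
  ring

lemma w_G : w1 m ∈ Gset m Q₀ := by
  rw [G_iff]
  intro v w
  obtain ⟨x, X, y, rfl⟩ := tv_surj v
  obtain ⟨x', X', y', rfl⟩ := tv_surj w
  obtain ⟨p, A, q, rfl⟩ := tv_surj X
  obtain ⟨p', A', q', rfl⟩ := tv_surj X'
  rw [w_tv, w_tv, pair_tv, pair_tv, pair1_tv, pair1_tv]
  ring

lemma w_w : w1 m * w1 m = 1 := by
  apply mat_ext
  intro v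
  obtain ⟨x, X, y, rfl⟩ := tv_surj v
  obtain ⟨p, A, q, rfl⟩ := tv_surj X
  rw [← Matrix.mulVec_mulVec, w_tv, w_tv, Matrix.one_mulVec]

lemma n_n (hsym : Q₀.IsSymm) (Y Z : Idx1 m → ℚ) :
    nElt m Q₀ Y * nElt m Q₀ Z = nElt m Q₀ (Y + Z) := by
  apply mat_ext
  intro v
  obtain ⟨x, X, y, rfl⟩ := tv_surj v
  rw [← Matrix.mulVec_mulVec, n_tv, n_tv, n_tv]
  simp only [pair1_add_left, pair1_add_right, pair1_smul_left, pair1_smul_right]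
  rw [pair1_symm hsym Z Y]
  congr 1
  · ring
  · rw [smul_add]; abel

lemma m_m (r s : ℚ) (h k : Matrix (Idx1 m) (Idx1 m) ℚ) :
    mElt m r h * mElt m s k = mElt m (r * s) (h * k) := by
  apply mat_ext
  intro v
  obtain ⟨x, X, y, rfl⟩ := tv_surj v
  rw [← Matrix.mulVec_mulVec, m_tv, m_tv, m_tv, Matrix.mulVec_mulVec]
  congr 1
  · ring
  · rw [mul_inv]; ring

lemma n_m {t : ℚ} (ht : t ≠ 0) {h : Matrix (Idx1 m) (Idx1 m) ℚ} (hh : h ∈ G1set m Q₀)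
    (Z : Idx1 m → ℚ) :
    nElt m Q₀ (t • (h *ᵥ Z)) * mElt m t h = mElt m t h * nElt m Q₀ Z := by
  rw [G1_iff] at hh
  apply mat_ext
  intro v
  obtain ⟨x, X, y, rfl⟩ := tv_surj v
  rw [← Matrix.mulVec_mulVec, ← Matrix.mulVec_mulVec, m_tv, n_tv, n_tv, m_tv]
  simp only [pair1_smul_left, pair1_smul_right, hh, Matrix.mulVec_add, Matrix.mulVec_smul, smul_smul]
  congr 1
  · field_simp
  · congr 2
    field_simp

lemma P_iff (hsym : Q₀.IsSymm)
    (hpos : ∀ x : Fin (m - 2) → ℚ, x ≠ 0 → 0 < x ⬝ᵥ Q₀.mulVec x)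
    {g : Matrix (Idx m) (Idx m) ℚ} :
    g ∈ Pset m Q₀ ↔ g ∈ Gset m Q₀ ∧ ∃ r : ℚ, r ≠ 0 ∧ g *ᵥ tv 1 0 0 = tv r 0 0 := by
  constructor
  · rintro ⟨r, hr, h, hh, X, rfl⟩
    refine ⟨G_mul (m_G hr hh) (n_G hsym X), r, hr, ?_⟩
    rw [← Matrix.mulVec_mulVec, n_tv, m_tv]
    simp [pair1_zero_right]
  · rintro ⟨hg, r, hr, h1⟩
    rw [G_iff] at hg
    obtain ⟨s, x, w, h2⟩ := tv_surj (g *ᵥ tv 0 0 1)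
    let h : Matrix (Idx1 m) (Idx1 m) ℚ := fun i j => g (Sum.inr (Sum.inl i)) (Sum.inr (Sum.inl j))
    have h3 : ∀ X, ∃ u v, g *ᵥ tv 0 X 0 = tv u (h *ᵥ X) v := by
      intro X
      refine ⟨(g *ᵥ tv 0 X 0) (Sum.inl ()), (g *ᵥ tv 0 X 0) (Sum.inr (Sum.inr ())), ?_⟩
      · funext i
        rcases i with i | i | i
        · rfl
        · rw [Matrix.mulVec, dotProduct, Fintype.sum_sum_type, Fintype.sum_sum_type]
          simp [tv, h, Matrix.mulVec, dotProduct]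
        · rfl
    choose u v h3 using h3
    have hv : ∀ X, v X = 0 := by
      intro X
      have := hg (tv 1 0 0) (tv 0 X 0)
      rw [h1, h3, pair_tv, pair_tv] at this
      simpa [pair1_zero_left, hr] using this
    have hw : w = r⁻¹ := by
      have := hg (tv 1 0 0) (tv 0 0 1)
      rw [h1, h2, pair_tv, pair_tv] at this
      simp [pair1_zero_left] at this
      exact eq_inv_of_mul_eq_one_right this
    have hh : h ∈ G1set m Q₀ := by
      rw [G1_iff]
      intro X Y
      have := hg (tv 0 X 0) (tv 0 Y 0)
      rw [h3, h3, pair_tv, pair_tv, hv, hv] at this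
      simpa using this
    have hu := G1_unit hpos hh
    have hx : x = h *ᵥ (h⁻¹ *ᵥ x) := (mul_inv_vec hu x).symm
    generalize h⁻¹ *ᵥ x = Y at hx
    have hh' := G1_iff.1 hh
    have hU : ∀ X, u X = - r * pairQ1 m Q₀ Y X := by
      intro X
      have := hg (tv 0 0 1) (tv 0 X 0)
      rw [h2, h3, pair_tv, pair_tv, hv, hw, hx, hh'] at this
      simp only [pair1_zero_left] at this
      field_simp at this
      linarith
    have hS : s = - r * pairQ1 m Q₀ Y Y / 2 := by
      have := hg (tv 0 0 1) (tv 0 0 1)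
      rw [h2, pair_tv, pair_tv, hw, hx, hh'] at this
      simp only [pair1_zero_left] at this
      field_simp at this
      linarith
    refine ⟨r, hr, h, hh, Y, ?_⟩
    apply mat_ext
    intro z
    obtain ⟨p, X, q, rfl⟩ := tv_surj z
    have : tv p X q = p • tv 1 0 0 + tv 0 X 0 + q • tv 0 0 1 := by
      simp [smul_tv, add_tv]
    rw [← Matrix.mulVec_mulVec, n_tv, m_tv, this, Matrix.mulVec_add, Matrix.mulVec_add,
      Matrix.mulVec_smul, Matrix.mulVec_smul, h1, h2, h3, smul_tv, smul_tv, add_tv, add_tv,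
      hv, hU, hS, hw, hx, Matrix.mulVec_add, Matrix.mulVec_smul]
    congr 1
    · ring
    · simp
    · ring

lemma smallCoset_sub (hsym : Q₀.IsSymm)
    (hpos : ∀ x : Fin (m - 2) → ℚ, x ≠ 0 → 0 < x ⬝ᵥ Q₀.mulVec x)
    (a : ℚ) (α : Fin (m - 2) → ℚ) {t : ℚ} (ht : t ≠ 0) {h δ : Matrix (Idx1 m) (Idx1 m) ℚ}
    (hδ : δ ∈ G1set m Q₀) (hh : h ∈ P10 m Q₀) :
    smallCoset m Q₀ a α t (h * δ) ⊆ smallCoset m Q₀ a α t δ := by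
  obtain ⟨hG, c, hc, hce⟩ := hh
  rw [e0_eq, smul_tv] at hce
  simp only [mul_one, smul_zero, mul_zero] at hce
  have hu := G1_unit hpos hG
  have hh' := G1_iff.1 hG
  rintro g ⟨p, ⟨hp, hpx⟩, X, rfl⟩
  obtain ⟨Y, hY⟩ : ∃ Y, h *ᵥ (tv 0 α 0 + Y) = tv 0 α 0 :=
    ⟨h⁻¹ *ᵥ tv 0 α 0 - tv 0 α 0, by rw [add_sub_cancel, mul_inv_vec hu]⟩
  have hY0 : pairQ1 m Q₀ Y (tv 1 0 0) = 0 := by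
    have := hh' (tv 0 α 0 + Y) (tv 1 0 0)
    rw [hY, hce, pair1_add_left, pair1_tv, pair1_tv] at this
    simp at this
    linarith
  have hYY : pairQ1 m Q₀ Y (tv 0 α 0) + pairQ1 m Q₀ Y Y / 2 = 0 := by
    have := hh' (tv 0 α 0 + Y) (tv 0 α 0 + Y)
    rw [hY, pair1_add_left, pair1_add_right, pair1_add_right, pair1_symm hsym (tv 0 α 0) Y] at this
    linarith
  have hδu := G1_unit hpos hδ
  have hcomm : nElt m Q₀ Y * mElt m t δ = mElt m t δ * nElt m Q₀ (t⁻¹ • (δ⁻¹ *ᵥ Y)) := by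
    rw [← n_m ht hδ, Matrix.mulVec_smul, mul_inv_vec hδu, smul_smul, mul_inv_cancel₀ ht, one_smul]
  obtain ⟨hpG, r, hr, hpr⟩ := (P_iff hsym hpos).1 hp
  refine ⟨p * (w1 m * mElt m 1 h * nElt m Q₀ Y * w1 m), ⟨(P_iff hsym hpos).2 ⟨?_, r * c, ?_, ?_⟩, ?_⟩,
    -(t⁻¹ • (δ⁻¹ *ᵥ Y)) + X, ?_⟩
  · exact G_mul hpG (G_mul (G_mul (G_mul w_G (m_G one_ne_zero hG)) (n_G hsym Y)) w_G)
  · exact mul_ne_zero hr hc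
  · have e : (tv 1 0 0 : Idx m → ℚ) = tv 1 (tv 0 0 0) 0 := by rw [← zero_tv]
    have e2 : (tv c 0 0 : Idx m → ℚ) = c • tv 1 0 0 := by simp [smul_tv]
    simp only [← Matrix.mulVec_mulVec]
    rw [e, w_tv, n_tv, hY0, m_tv]
    simp only [zero_mul, smul_zero, zero_smul, add_zero, hce]
    rw [show (1 * (0 - 0 - 0 / 2) : ℚ) = 0 by norm_num, mul_zero, w_tv, ← zero_tv, e2,
      Matrix.mulVec_smul, hpr, smul_tv]
    simp [mul_comm]
  · simp only [← Matrix.mulVec_mulVec]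
    rw [xiV_eq] at hpx ⊢
    rw [w_tv, n_tv, m_tv, one_smul, hY]
    rw [show (1 * (a - pairQ1 m Q₀ Y (tv 0 α 0) - 1 * pairQ1 m Q₀ Y Y / 2) : ℚ) = a by linarith,
      inv_one, one_mul, w_tv, hpx]
  · have e1 : p * (w1 m * mElt m 1 h * nElt m Q₀ Y * w1 m) * w1 m * mElt m t δ
        = p * w1 m * mElt m 1 h * (nElt m Q₀ Y * mElt m t δ) := by
      have : p * (w1 m * mElt m 1 h * nElt m Q₀ Y * w1 m) * w1 m * mElt m t δ
        = p * (w1 m * mElt m 1 h * nElt m Q₀ Y * (w1 m * w1 m)) * mElt m t δ := by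
        simp only [Matrix.mul_assoc]
      rw [this, w_w]
      simp only [Matrix.mul_assoc, Matrix.mul_one, Matrix.one_mul]
    rw [e1, hcomm]
    have e2 : p * w1 m * mElt m 1 h * (mElt m t δ * nElt m Q₀ (t⁻¹ • (δ⁻¹ *ᵥ Y))) *
        nElt m Q₀ (-(t⁻¹ • (δ⁻¹ *ᵥ Y)) + X) = p * w1 m * (mElt m 1 h * mElt m t δ) *
        (nElt m Q₀ (t⁻¹ • (δ⁻¹ *ᵥ Y)) * nElt m Q₀ (-(t⁻¹ • (δ⁻¹ *ᵥ Y)) + X)) := by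
      simp only [Matrix.mul_assoc]
    rw [e2, n_n hsym, m_m, one_mul, add_neg_cancel_left]

lemma P10_inv (hpos : ∀ x : Fin (m - 2) → ℚ, x ≠ 0 → 0 < x ⬝ᵥ Q₀.mulVec x)
    {h : Matrix (Idx1 m) (Idx1 m) ℚ} (hh : h ∈ P10 m Q₀) : h⁻¹ ∈ P10 m Q₀ := by
  obtain ⟨hG, c, hc, hce⟩ := hh
  refine ⟨G1_inv hpos hG, c⁻¹, inv_ne_zero hc, ?_⟩
  have := inv_mul_vec (G1_unit hpos hG) (e0 m)
  rw [hce, Matrix.mulVec_smul] at this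
  rw [← this, smul_smul, inv_mul_cancel₀ hc, one_smul, this]

lemma part_b (hsym : Q₀.IsSymm)
    (hpos : ∀ x : Fin (m - 2) → ℚ, x ≠ 0 → 0 < x ⬝ᵥ Q₀.mulVec x)
    (a : ℚ) (α : Fin (m - 2) → ℚ) (t₁ t₂ : ℚ) (ht₂ : t₂ ≠ 0)
    (δ₁ δ₂ : Matrix (Idx1 m) (Idx1 m) ℚ) (h₁ : δ₁ ∈ G1set m Q₀) (h₂ : δ₂ ∈ G1set m Q₀)
    (hne : (smallCoset m Q₀ a α t₁ δ₁ ∩ smallCoset m Q₀ a α t₂ δ₂).Nonempty) :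
    t₁ = t₂ ∧ δ₁ * δ₂⁻¹ ∈ P10 m Q₀ := by
  obtain ⟨g, ⟨p, ⟨hp, hpx⟩, X, rfl⟩, ⟨q, ⟨hq, hqx⟩, Y, hE⟩⟩ := hne
  obtain ⟨hpG, r, hr, hpr⟩ := (P_iff hsym hpos).1 hp
  obtain ⟨hqG, s, hs, hqs⟩ := (P_iff hsym hpos).1 hq
  have hpu : IsUnit p := orth_unit (Q_nondeg hpos) hpG
  have hE' : ∀ v, p *ᵥ (w1 m *ᵥ (mElt m t₁ δ₁ *ᵥ (nElt m Q₀ X *ᵥ v))) =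
      q *ᵥ (w1 m *ᵥ (mElt m t₂ δ₂ *ᵥ (nElt m Q₀ Y *ᵥ v))) := by
    intro v
    have := congrArg (· *ᵥ v) hE
    simpa only [← Matrix.mulVec_mulVec] using this
  have hu2 := G1_unit hpos h₂
  constructor
  · have := hE' (tv 1 0 0)
    rw [n_tv, n_tv, m_tv, m_tv] at this
    simp only [pair1_zero_right, zero_mul, zero_div, sub_zero, mul_one, zero_smul, add_zero,
      Matrix.mulVec_zero, mul_zero] at this
    rw [zero_tv, w_tv, w_tv] at this
    have h3 := G_iff.1 hpG (tv 0 (tv t₁ 0 0) 0) (xiV m a α)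
    have h4 := G_iff.1 hqG (tv 0 (tv t₂ 0 0) 0) (xiV m a α)
    rw [hpx, this] at h3
    rw [hqx, h3, xiV_eq, pair_tv, pair_tv, pair1_tv, pair1_tv] at h4
    simpa using h4
  · refine ⟨G1_mul h₁ (G1_inv hpos h₂), s / r, div_ne_zero hs hr, ?_⟩
    obtain ⟨b, hb⟩ : ∃ b, nElt m Q₀ Y *ᵥ tv b (δ₂⁻¹ *ᵥ tv 1 0 0) 0 =
        tv 0 (δ₂⁻¹ *ᵥ tv 1 0 0) 0 :=
      ⟨pairQ1 m Q₀ Y (δ₂⁻¹ *ᵥ tv 1 0 0), by rw [n_tv]; simp⟩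
    have := hE' (tv b (δ₂⁻¹ *ᵥ tv 1 0 0) 0)
    rw [hb, n_tv, m_tv, m_tv, mul_inv_vec hu2] at this
    simp only [zero_smul, add_zero, mul_zero] at this
    obtain ⟨x, A, y, hA⟩ := tv_surj (δ₁ *ᵥ (δ₂⁻¹ *ᵥ tv 1 0 0))
    rw [hA, w_tv, w_tv, ← zero_tv, hqs] at this
    have h5 : (tv s 0 0 : Idx m → ℚ) = p *ᵥ tv (s / r) 0 0 := by
      have : (tv (s / r) 0 0 : Idx m → ℚ) = (s / r) • tv 1 0 0 := by simp [smul_tv]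
      rw [this, Matrix.mulVec_smul, hpr, smul_tv]
      simp [hr]
    rw [h5] at this
    have h6 := (Matrix.mulVec_injective_iff_isUnit.2 hpu) this
    obtain ⟨rfl, h7, rfl⟩ := tv_inj h6
    rw [zero_tv] at h7
    obtain ⟨-, rfl, -⟩ := tv_inj h7
    rw [e0_eq, ← Matrix.mulVec_mulVec, hA, smul_tv]
    simp

end Helpers

/-- The double coset `P^ξ(ℚ)𝔴₁P(ℚ)` is the union of the sets
`P^ξ(ℚ)𝔴₁m(t;δ)N(ℚ)` over `t ∈ ℚ^×`, `δ ∈ G₁(ℚ)`; two such sets coincide when `t₁ = t₂` and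
`δ₁δ₂⁻¹ ∈ P₁⁰(ℚ)`, and conversely any two of them meeting satisfy `t₁ = t₂` and
`δ₁δ₂⁻¹ ∈ P₁⁰(ℚ)`.  Hence `P^ξ(ℚ)𝔴₁P(ℚ)` is the disjoint union of the sets
`P^ξ(ℚ)𝔴₁m(t;δ)N(ℚ)`, `t ∈ ℚ^×`, `δ ∈ P₁⁰(ℚ)\G₁(ℚ)`. -/
theorem stmt5 (m : ℕ) (hm : 3 ≤ m)
    (Q₀ : Matrix (Fin (m - 2)) (Fin (m - 2)) ℚ) (hsym : Q₀.IsSymm)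
    (hpos : ∀ x : Fin (m - 2) → ℚ, x ≠ 0 → 0 < x ⬝ᵥ Q₀.mulVec x)
    (a : ℚ) (α : Fin (m - 2) → ℚ)
    (hξ : pairQ1 m Q₀ (xiVec m a α) (xiVec m a α) < 0) :
    (DCoset m Q₀ a α (w1 m) =
      ⋃ (t : ℚ) (_ : t ≠ 0) (δ : Matrix (Idx1 m) (Idx1 m) ℚ) (_ : δ ∈ G1set m Q₀),
        smallCoset m Q₀ a α t δ) ∧
    (∀ t₁ t₂ : ℚ, t₁ ≠ 0 → t₂ ≠ 0 → ∀ δ₁ ∈ G1set m Q₀, ∀ δ₂ ∈ G1set m Q₀,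
      t₁ = t₂ → δ₁ * δ₂⁻¹ ∈ P10 m Q₀ →
        smallCoset m Q₀ a α t₁ δ₁ = smallCoset m Q₀ a α t₂ δ₂) ∧
    (∀ t₁ t₂ : ℚ, t₁ ≠ 0 → t₂ ≠ 0 → ∀ δ₁ ∈ G1set m Q₀, ∀ δ₂ ∈ G1set m Q₀,
      (smallCoset m Q₀ a α t₁ δ₁ ∩ smallCoset m Q₀ a α t₂ δ₂).Nonempty →
        t₁ = t₂ ∧ δ₁ * δ₂⁻¹ ∈ P10 m Q₀) := by
  refine ⟨?_, ?_, ?_⟩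
  · ext g
    simp only [Set.mem_iUnion]
    constructor
    · rintro ⟨p, hp, q, ⟨r, hr, h, hh, X, rfl⟩, rfl⟩
      exact ⟨r, hr, h, hh, p, hp, X, by simp only [Matrix.mul_assoc]⟩
    · rintro ⟨r, hr, h, hh, p, hp, X, rfl⟩
      exact ⟨p, hp, _, ⟨r, hr, h, hh, X, rfl⟩, by simp only [Matrix.mul_assoc]⟩
  · rintro t _ ht - δ₁ h₁ δ₂ h₂ rfl h
    have u1 := (Matrix.isUnit_iff_isUnit_det _).1 (G1_unit hpos h₁)
    have u2 := (Matrix.isUnit_iff_isUnit_det _).1 (G1_unit hpos h₂)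
    apply Set.Subset.antisymm
    · have := smallCoset_sub hsym hpos a α ht h₂ h
      rwa [Matrix.mul_assoc, Matrix.nonsing_inv_mul _ u2, Matrix.mul_one] at this
    · have := smallCoset_sub hsym hpos a α ht h₁ (P10_inv hpos h)
      rwa [Matrix.mul_inv_rev, Matrix.nonsing_inv_nonsing_inv _ u2, Matrix.mul_assoc,
        Matrix.nonsing_inv_mul _ u1, Matrix.mul_one] at this
  · intro t₁ t₂ _ ht₂ δ₁ h₁ δ₂ h₂ hne
    exact part_b hsym hpos a α t₁ t₂ ht₂ δ₁ δ₂ h₁ h₂ hne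
end
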